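/- arXiv:1010.5184 — 2 statements merged into one kernel-verified Lean document; each statement's English description precedes it below -/
import Mathlib

section
/- Let d be a positive integer. The space I_d is exactly the space of smooth functions φ : ℝ → ℂ such that φ and all of its derivatives have asymptotic expansions at infinity and the asymptotic expansion of φ has the form φ(x) ≈ a_{d+1} x^{−d−1} + a_{d+2} x^{−d−2} + … (i.e. the coefficients a_0, a_1, …, a_d all vanish). -/
open MeasureTheory Set

/-- Membership in the space `I_d`: `φ` is smooth on `ℝ` and the function
`x ↦ x^{-d-1} φ(-1/x)` (defined for `x ≠ 0`) extends to a smooth function on `ℝ`. -/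
def MemI (d : ℕ) (φ : ℝ → ℂ) : Prop :=
  ContDiff ℝ (⊤ : ℕ∞) φ ∧
    ∃ ψ : ℝ → ℂ, ContDiff ℝ (⊤ : ℕ∞) ψ ∧ ∀ x : ℝ, x ≠ 0 → ψ x = ((x : ℂ) ^ (d + 1))⁻¹ * φ (-1 / x)

/-- `ψ` has the asymptotic expansion `ψ(x) ≈ Σ_{m=0}^∞ a_m x^{-m}` at infinity:
for every `N`, `ψ(x) - Σ_{m=0}^N a_m x^{-m} = O(|x|^{-N-1})` as `|x| → ∞`. -/
def HasAsymptoticExpansion (ψ : ℝ → ℂ) (a : ℕ → ℂ) : Prop :=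
  ∀ N : ℕ, ∃ C R : ℝ, ∀ x : ℝ, R ≤ |x| →
    ‖ψ x - ∑ m ∈ Finset.range (N + 1), a m / (x : ℂ) ^ m‖ * |x| ^ (N + 1) ≤ C

open Filter Topology Asymptotics Bornology

/-- A smooth function all of whose derivatives have asymptotic expansions at infinity. -/
def HasSmoothExpansion (f : ℝ → ℂ) : Prop :=
  ContDiff ℝ (⊤ : ℕ∞) f ∧ ∀ n : ℕ, ∃ a : ℕ → ℂ, HasAsymptoticExpansion (iteratedDeriv n f) a

theorem eventually_cobounded_iff_abs {p : ℝ → Prop} :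
    (∀ᶠ x in cobounded ℝ, p x) ↔ ∃ R : ℝ, ∀ x : ℝ, R ≤ |x| → p x := by
  rw [← comap_norm_atTop, eventually_comap, eventually_atTop]
  constructor
  · rintro ⟨R, h⟩
    exact ⟨R, fun x hx => h _ hx x rfl⟩
  · rintro ⟨R, h⟩
    refine ⟨R, fun b hb x hx => h x ?_⟩
    rw [← Real.norm_eq_abs, hx]
    exact hb

theorem hasAsymptoticExpansion_iff_isBigO_succ {f : ℝ → ℂ} {a : ℕ → ℂ} :
    HasAsymptoticExpansion f a ↔ ∀ N : ℕ,
      (fun x : ℝ => f x - ∑ m ∈ Finset.range (N + 1), a m / (x : ℂ) ^ m)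
        =O[cobounded ℝ] fun x : ℝ => (x ^ (N + 1))⁻¹ := by
  refine forall_congr' fun N => ?_
  rw [isBigO_iff]
  refine exists_congr fun C => ?_
  rw [← eventually_cobounded_iff_abs]
  refine eventually_congr ((eventually_ne_cobounded (0 : ℝ)).mono fun x hx => ?_)
  rw [norm_inv, norm_pow, Real.norm_eq_abs, ← div_eq_mul_inv, le_div_iff₀ (by positivity)]

theorem HasAsymptoticExpansion.isBigO {f : ℝ → ℂ} {a : ℕ → ℂ}
    (h : HasAsymptoticExpansion f a) (N : ℕ) :
    (fun x : ℝ => f x - ∑ m ∈ Finset.range N, a m / (x : ℂ) ^ m)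
      =O[cobounded ℝ] fun x : ℝ => (x ^ N)⁻¹ := by
  have h1 := hasAsymptoticExpansion_iff_isBigO_succ.1 h N
  have h2 : (fun x : ℝ => (x ^ (N + 1))⁻¹) =O[cobounded ℝ] fun x : ℝ => (x ^ N)⁻¹ := by
    refine IsBigO.of_bound 1 ?_
    filter_upwards [eventually_cobounded_iff_abs.2 ⟨1, fun x hx => hx⟩] with x hx
    rw [one_mul, norm_inv, norm_inv, norm_pow, norm_pow, Real.norm_eq_abs]
    gcongr
    omega
  have h3 : (fun x : ℝ => a N / (x : ℂ) ^ N) =O[cobounded ℝ] fun x : ℝ => (x ^ N)⁻¹ := by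
    refine IsBigO.of_bound ‖a N‖ (Eventually.of_forall fun x => le_of_eq ?_)
    simp [div_eq_mul_inv]
  refine ((h1.trans h2).add h3).congr_left fun x => ?_
  rw [Finset.sum_range_succ]
  ring

theorem hasAsymptoticExpansion_iff_isBigO {f : ℝ → ℂ} {a : ℕ → ℂ} :
    HasAsymptoticExpansion f a ↔ ∀ N : ℕ,
      (fun x : ℝ => f x - ∑ m ∈ Finset.range N, a m / (x : ℂ) ^ m)
        =O[cobounded ℝ] fun x : ℝ => (x ^ N)⁻¹ :=
  ⟨fun h => h.isBigO, fun h => hasAsymptoticExpansion_iff_isBigO_succ.2 fun N => h (N + 1)⟩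

theorem HasAsymptoticExpansion.tendsto {f : ℝ → ℂ} {a : ℕ → ℂ}
    (h : HasAsymptoticExpansion f a) : Tendsto f (cobounded ℝ) (𝓝 (a 0)) := by
  have h1 := h.isBigO 1
  have h2 : Tendsto (fun x : ℝ => (x ^ 1)⁻¹) (cobounded ℝ) (𝓝 0) := by
    simpa using tendsto_inv₀_cobounded (α := ℝ)
  have h3 := (h1.trans_tendsto h2).add_const (a 0)
  simpa using h3

theorem HasAsymptoticExpansion.add_const_mul {f g : ℝ → ℂ} {a b : ℕ → ℂ}
    (hf : HasAsymptoticExpansion f a) (hg : HasAsymptoticExpansion g b) (c : ℂ) :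
    HasAsymptoticExpansion (fun x => f x + c * g x) (fun m => a m + c * b m) := by
  rw [hasAsymptoticExpansion_iff_isBigO]
  intro N
  refine ((hf.isBigO N).add ((hg.isBigO N).const_mul_left c)).congr_left fun x => ?_
  simp only [add_div, Finset.sum_add_distrib, mul_sub, Finset.mul_sum, mul_div_assoc]
  ring

theorem HasAsymptoticExpansion.id_mul {f : ℝ → ℂ} {a : ℕ → ℂ}
    (h : HasAsymptoticExpansion f a) (h0 : a 0 = 0) :
    HasAsymptoticExpansion (fun x => x * f x) (fun m => a (m + 1)) := by
  rw [hasAsymptoticExpansion_iff_isBigO]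
  intro N
  have hx : (fun x : ℝ => (x : ℂ)) =O[cobounded ℝ] fun x : ℝ => x :=
    IsBigO.of_bound 1 (Eventually.of_forall fun x => by simp)
  refine (hx.mul (h.isBigO (N + 1))).congr' ?_ ?_
  · filter_upwards [eventually_ne_cobounded (0 : ℝ)] with x hx
    have hx' : (x : ℂ) ≠ 0 := by exact_mod_cast hx
    rw [Finset.sum_range_succ', h0, mul_sub]
    simp only [zero_div, add_zero, Finset.mul_sum]
    congr 1
    refine Finset.sum_congr rfl fun m _ => ?_
    field_simp
    ring
  · filter_upwards [eventually_ne_cobounded (0 : ℝ)] with x hx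
    field_simp
    ring

theorem HasAsymptoticExpansion.congr {f g : ℝ → ℂ} {a : ℕ → ℂ}
    (h : HasAsymptoticExpansion f a) (hfg : ∀ x ≠ 0, f x = g x) :
    HasAsymptoticExpansion g a := by
  rw [hasAsymptoticExpansion_iff_isBigO]
  intro N
  refine (h.isBigO N).congr' ?_ .rfl
  filter_upwards [eventually_ne_cobounded (0 : ℝ)] with x hx
  rw [hfg x hx]

theorem HasAsymptoticExpansion.div_id {f : ℝ → ℂ} {a : ℕ → ℂ}
    (h : HasAsymptoticExpansion f a) :
    HasAsymptoticExpansion (fun x => f x / x) (fun m => if m = 0 then 0 else a (m - 1)) := by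
  rw [hasAsymptoticExpansion_iff_isBigO_succ]
  intro N
  have hx : (fun x : ℝ => (x : ℂ)⁻¹) =O[cobounded ℝ] fun x : ℝ => x⁻¹ :=
    IsBigO.of_bound 1 (Eventually.of_forall fun x => by simp)
  refine (hx.mul (h.isBigO N)).congr' ?_ ?_
  · filter_upwards with x
    rw [Finset.sum_range_succ', mul_sub, Finset.mul_sum]
    simp only [Nat.add_eq_zero_iff, one_ne_zero, and_false, if_false, if_true, zero_div, add_zero,
      Nat.add_sub_cancel]
    congr 1
    · ring
    · refine Finset.sum_congr rfl fun m _ => ?_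
      rw [pow_succ, div_mul_eq_div_div]
      ring
  · filter_upwards with x
    rw [pow_succ, mul_inv, mul_comm]

theorem HasAsymptoticExpansion.div_pow {f : ℝ → ℂ} {a : ℕ → ℂ}
    (h : HasAsymptoticExpansion f a) (k : ℕ) :
    ∃ b : ℕ → ℂ, HasAsymptoticExpansion (fun x => f x / (x : ℂ) ^ k) b ∧ ∀ m < k, b m = 0 := by
  induction k with
  | zero => exact ⟨a, by simpa using h, by simp⟩
  | succ k ih =>
    obtain ⟨b, hb, hb0⟩ := ih
    refine ⟨_, hb.div_id.congr fun x _ => by rw [pow_succ, div_mul_eq_div_div], fun m hm => ?_⟩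
    split_ifs with h0
    · rfl
    · exact hb0 _ (by omega)

theorem tendsto_neg_one_div_cobounded :
    Tendsto (fun x : ℝ => -1 / x) (cobounded ℝ) (𝓝 0) := by
  have := (tendsto_inv₀_cobounded (α := ℝ)).neg
  simpa [div_eq_mul_inv] using this

theorem tendsto_neg_one_div_nhdsNE_zero :
    Tendsto (fun x : ℝ => -1 / x) (𝓝[≠] 0) (cobounded ℝ) := by
  have h := (tendsto_inv₀_nhdsNE_zero (α := ℝ))
  rw [← tendsto_norm_atTop_iff_cobounded] at h ⊢
  simpa [div_eq_mul_inv] using h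

theorem exists_hasAsymptoticExpansion_of_contDiff {g : ℝ → ℂ} (hg : ContDiff ℝ (⊤ : ℕ∞) g) :
    ∃ a : ℕ → ℂ, HasAsymptoticExpansion (fun x => g (-1 / x)) a := by
  refine ⟨fun m => ((m.factorial : ℂ)⁻¹ * (-1) ^ m) * iteratedDerivWithin m g univ 0, ?_⟩
  rw [hasAsymptoticExpansion_iff_isBigO]
  intro N
  have h1 := taylor_isLittleO_univ (x₀ := 0) (n := N) (hg.of_le (by exact_mod_cast le_top))
  have h2 : (fun y : ℝ => g y - ∑ m ∈ Finset.range N,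
      ((m.factorial : ℂ)⁻¹ * y ^ m) * iteratedDerivWithin m g univ 0) =O[𝓝 0] fun y => y ^ N := by
    have h3 : (fun y : ℝ => ((N.factorial : ℂ)⁻¹ * y ^ N) * iteratedDerivWithin N g univ 0)
        =O[𝓝 0] fun y => y ^ N := by
      refine IsBigO.of_bound (‖(N.factorial : ℂ)⁻¹‖ * ‖iteratedDerivWithin N g univ 0‖)
        (Eventually.of_forall fun y => le_of_eq ?_)
      simp only [norm_mul, norm_pow, Complex.norm_real]
      ring
    simp only [sub_zero] at h1
    refine (h1.isBigO.add h3).congr_left fun y => ?_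
    rw [taylor_within_apply, Finset.sum_range_succ]
    simp
    ring
  refine ((h2.comp_tendsto tendsto_neg_one_div_cobounded).congr_left fun x => ?_).trans ?_
  · simp only [Function.comp_apply]
    congr 1
    refine Finset.sum_congr rfl fun m _ => ?_
    push_cast
    rw [div_pow]
    ring
  · refine IsBigO.of_bound 1 (Eventually.of_forall fun x => ?_)
    simp

theorem hasDerivAt_comp_neg_one_div {f : ℝ → ℂ} (hf : Differentiable ℝ f) {x : ℝ} (hx : x ≠ 0) :
    HasDerivAt (fun y => f (-1 / y)) (((x : ℂ) ^ 2)⁻¹ * deriv f (-1 / x)) x := by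
  have h1 : HasDerivAt (fun y : ℝ => -1 / y) ((x ^ 2)⁻¹) x := by
    have := (hasDerivAt_inv hx).neg
    simpa [div_eq_mul_inv, Pi.neg_def] using this
  have h2 := (hf (-1 / x)).hasDerivAt.scomp x h1
  simpa [Function.comp_def] using h2

theorem hasSmoothExpansion_of_eq_comp {f g : ℝ → ℂ} (hf : ContDiff ℝ (⊤ : ℕ∞) f)
    (hg : ContDiff ℝ (⊤ : ℕ∞) g) (hfg : ∀ x ≠ 0, f x = g (-1 / x)) : HasSmoothExpansion f := by
  refine ⟨hf, fun n => ?_⟩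
  induction n generalizing f g with
  | zero =>
    obtain ⟨a, ha⟩ := exists_hasAsymptoticExpansion_of_contDiff hg
    exact ⟨a, by simpa using ha.congr fun x hx => (hfg x hx).symm⟩
  | succ n ih =>
    rw [iteratedDeriv_succ']
    refine ih (contDiff_infty_iff_deriv.1 hf).2 (g := fun y => (y : ℂ) ^ 2 * deriv g y)
      ((Complex.ofRealCLM.contDiff.pow 2).mul (contDiff_infty_iff_deriv.1 hg).2) fun x hx => ?_
    have h1 : f =ᶠ[𝓝 x] fun y => g (-1 / y) := by
      filter_upwards [isOpen_ne.mem_nhds hx] with y hy using hfg y hy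
    rw [h1.deriv_eq, (hasDerivAt_comp_neg_one_div (hg.differentiable (by simp)) hx).deriv]
    congr 1
    push_cast
    field_simp

theorem HasAsymptoticExpansion.deriv_coeff_eq_zero {f : ℝ → ℂ} {a b : ℕ → ℂ}
    (hf : Differentiable ℝ f) (ha : HasAsymptoticExpansion f a)
    (hb : HasAsymptoticExpansion (deriv f) b) : b 0 = 0 ∧ b 1 = 0 := by
  obtain ⟨C, R, hC⟩ := hb 1
  have hbound : ∀ x : ℝ, max R 1 ≤ x →
      ‖(f (2 * x) - f x) - (b 0 * x + b 1 * Real.log 2)‖ ≤ C / x := by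
    intro x hx
    have hx1 : 1 ≤ x := (le_max_right _ _).trans hx
    have hxR : R ≤ x := (le_max_left _ _).trans hx
    have hx0 : 0 < x := by linarith
    have hder : ∀ t ∈ Icc x (2 * x), HasDerivWithinAt
        (fun t : ℝ => f t - b 0 * t - b 1 * (Real.log t : ℝ))
        (deriv f t - b 0 - b 1 * (t⁻¹ : ℝ)) (Icc x (2 * x)) t := by
      intro t ht
      have ht0 : t ≠ 0 := (hx0.trans_le ht.1).ne'
      have h1 := (Complex.ofRealCLM.hasDerivAt (x := t)).const_mul (b 0)
      have h2 := ((Real.hasDerivAt_log ht0).ofReal_comp).const_mul (b 1)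
      have h3 := ((hf t).hasDerivAt.fun_sub h1).fun_sub h2
      simp only [Complex.ofRealCLM_apply, Complex.ofReal_one, mul_one] at h3
      exact h3.hasDerivWithinAt
    have hle : ∀ t ∈ Icc x (2 * x),
        ‖deriv f t - b 0 - b 1 * (t⁻¹ : ℝ)‖ ≤ C / x ^ 2 := by
      intro t ht
      have ht0 : 0 < t := hx0.trans_le ht.1
      have h1 := hC t (by rw [abs_of_pos ht0]; exact hxR.trans ht.1)
      rw [abs_of_pos ht0] at h1
      have h2 : deriv f t - ∑ m ∈ Finset.range (1 + 1), b m / (t : ℂ) ^ m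
          = deriv f t - b 0 - b 1 * (t⁻¹ : ℝ) := by
        simp [Finset.sum_range_succ, div_eq_mul_inv]
        ring
      rw [h2] at h1
      rw [le_div_iff₀ (by positivity)]
      refine le_trans ?_ h1
      gcongr
      exact ht.1
    have := (convex_Icc x (2 * x)).norm_image_sub_le_of_norm_hasDerivWithin_le hder hle
      (left_mem_Icc.2 (by linarith)) (right_mem_Icc.2 (by linarith))
    have e1 : C / x ^ 2 * ‖2 * x - x‖ = C / x := by
      rw [show 2 * x - x = x by ring, Real.norm_eq_abs, abs_of_pos hx0]
      field_simp
    rw [e1, Real.log_mul (by norm_num) hx0.ne'] at this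
    refine le_trans (le_of_eq ?_) this
    congr 1
    push_cast
    ring
  have hfin : Tendsto f atTop (𝓝 (a 0)) := ha.tendsto.mono_left (IsOrderBornology.atTop_le_cobounded)
  have h2x : Tendsto (fun x : ℝ => 2 * x) atTop atTop := tendsto_id.const_mul_atTop (by norm_num)
  have hdiff := (hfin.comp h2x).sub hfin
  have hz : Tendsto (fun x : ℝ => (f (2 * x) - f x) - (b 0 * x + b 1 * Real.log 2)) atTop (𝓝 0) := by
    refine squeeze_zero_norm' ?_ (tendsto_const_nhds (x := C).div_atTop tendsto_id)
    filter_upwards [eventually_ge_atTop (max R 1)] with x hx using hbound x hx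
  have hlin : Tendsto (fun x : ℝ => b 0 * x + b 1 * Real.log 2) atTop (𝓝 0) := by
    simpa using hdiff.sub hz
  have hb0 : b 0 = 0 := by
    have h1 : Tendsto (fun x : ℝ => x + 1) atTop atTop := tendsto_atTop_add_const_right _ _ tendsto_id
    have h2 := (hlin.comp h1).sub hlin
    have h3 : Tendsto (fun _ : ℝ => b 0) atTop (𝓝 0) := by
      simpa [Function.comp_def, mul_add] using h2
    exact tendsto_nhds_unique tendsto_const_nhds h3
  refine ⟨hb0, ?_⟩
  have h4 : b 1 * Real.log 2 = 0 := by
    simp only [hb0, zero_mul, zero_add] at hlin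
    exact tendsto_nhds_unique tendsto_const_nhds hlin
  refine (mul_eq_zero.1 h4).resolve_right ?_
  exact_mod_cast (Real.log_pos (by norm_num : (1 : ℝ) < 2)).ne'

theorem HasSmoothExpansion.deriv {f : ℝ → ℂ} (hf : HasSmoothExpansion f) :
    HasSmoothExpansion (deriv f) :=
  ⟨(contDiff_infty_iff_deriv.1 hf.1).2, fun n => by
    rw [← iteratedDeriv_succ']
    exact hf.2 (n + 1)⟩

theorem iteratedDeriv_succ_id_mul {f : ℝ → ℂ} (hf : ContDiff ℝ (⊤ : ℕ∞) f) (n : ℕ) :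
    iteratedDeriv (n + 1) (fun x : ℝ => (x : ℂ) * f x) =
      fun x : ℝ => x * iteratedDeriv (n + 1) f x + (n + 1) * iteratedDeriv n f x := by
  have key : ∀ {g : ℝ → ℂ} (_ : Differentiable ℝ g) (x : ℝ),
      HasDerivAt (fun x : ℝ => (x : ℂ) * g x) (g x + x * deriv g x) x := by
    intro g hg x
    simpa using (Complex.ofRealCLM.hasDerivAt (x := x)).fun_mul (hg x).hasDerivAt
  have hd : ∀ n, Differentiable ℝ (iteratedDeriv n f) := fun n =>
    hf.differentiable_iteratedDeriv n (by exact_mod_cast WithTop.coe_lt_top n)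
  induction n with
  | zero =>
    ext x
    rw [zero_add, iteratedDeriv_one, (key (hf.differentiable (by simp)) x).deriv]
    simp [iteratedDeriv_one]
    ring
  | succ n ih =>
    rw [iteratedDeriv_succ, ih]
    ext x
    rw [((key (hd (n + 1)) x).fun_add ((hd n x).hasDerivAt.const_mul _)).deriv,
      ← iteratedDeriv_succ, ← iteratedDeriv_succ]
    push_cast
    ring

theorem HasSmoothExpansion.id_mul {f : ℝ → ℂ} {a : ℕ → ℂ} (hf : HasSmoothExpansion f)
    (ha : HasAsymptoticExpansion f a) (h0 : a 0 = 0) :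
    HasSmoothExpansion (fun x => x * f x) := by
  refine ⟨Complex.ofRealCLM.contDiff.mul hf.1, fun n => ?_⟩
  cases n with
  | zero => exact ⟨_, by simpa using ha.id_mul h0⟩
  | succ n =>
    rw [iteratedDeriv_succ_id_mul hf.1]
    obtain ⟨b, hb⟩ := hf.2 n
    obtain ⟨c, hc⟩ := hf.2 (n + 1)
    have hc0 : c 0 = 0 := by
      refine (hb.deriv_coeff_eq_zero (b := c) ?_ ?_).1
      · exact hf.1.differentiable_iteratedDeriv n (by exact_mod_cast WithTop.coe_lt_top n)
      · rwa [← iteratedDeriv_succ]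
    exact ⟨_, (hc.id_mul hc0).add_const_mul hb (n + 1)⟩

theorem HasSmoothExpansion.pow_mul {f : ℝ → ℂ} {a : ℕ → ℂ} (hf : HasSmoothExpansion f)
    (ha : HasAsymptoticExpansion f a) {k : ℕ} (h0 : ∀ m < k, a m = 0) :
    HasSmoothExpansion (fun x => (x : ℂ) ^ k * f x) := by
  induction k generalizing f a with
  | zero => simpa using hf
  | succ k ih =>
    have := ih (hf.id_mul ha (h0 0 (by omega))) (ha.id_mul (h0 0 (by omega)))
      fun m hm => h0 (m + 1) (by omega)
    simpa only [pow_succ, mul_assoc] using this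

theorem HasSmoothExpansion.sq_mul_deriv {f : ℝ → ℂ} (hf : HasSmoothExpansion f) :
    HasSmoothExpansion (fun x => (x : ℂ) ^ 2 * _root_.deriv f x) := by
  obtain ⟨a, ha⟩ := hf.2 0
  obtain ⟨b, hb⟩ := hf.2 1
  rw [iteratedDeriv_zero] at ha
  rw [iteratedDeriv_one] at hb
  obtain ⟨h0, h1⟩ := ha.deriv_coeff_eq_zero (hf.1.differentiable (by simp)) hb
  refine hf.deriv.pow_mul hb fun m hm => ?_
  interval_cases m <;> assumption

theorem HasSmoothExpansion.contDiff_update {f : ℝ → ℂ} {a : ℕ → ℂ} (hf : HasSmoothExpansion f)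
    (ha : HasAsymptoticExpansion f a) (n : ℕ) :
    ContDiff ℝ n (Function.update (fun y : ℝ => f (-1 / y)) 0 (a 0)) := by
  have hc : ∀ {f : ℝ → ℂ} {a : ℕ → ℂ}, HasAsymptoticExpansion f a →
      ContinuousAt (Function.update (fun y : ℝ => f (-1 / y)) 0 (a 0)) 0 := fun ha =>
    continuousAt_update_same.2 (ha.tendsto.comp tendsto_neg_one_div_nhdsNE_zero)
  have hder : ∀ {f : ℝ → ℂ} {a : ℕ → ℂ}, HasSmoothExpansion f → HasAsymptoticExpansion f a →
      ∃ c, HasAsymptoticExpansion (fun x : ℝ => (x : ℂ) ^ 2 * _root_.deriv f x) c ∧ ∀ x,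
      HasDerivAt (Function.update (fun y : ℝ => f (-1 / y)) 0 (a 0))
        (Function.update (fun y : ℝ => ((-1 / y : ℝ) : ℂ) ^ 2 * _root_.deriv f (-1 / y)) 0 (c 0) x)
        x := by
    intro f a hf ha
    obtain ⟨c, hc'⟩ := hf.sq_mul_deriv.2 0
    rw [iteratedDeriv_zero] at hc'
    refine ⟨c, hc', hasDerivAt_of_hasDerivAt_of_ne' (fun x hx => ?_) (hc ha) (hc hc')⟩
    rw [Function.update_of_ne hx]
    refine ((hasDerivAt_comp_neg_one_div (hf.1.differentiable (by simp)) hx).congr_of_eventuallyEq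
      ?_).congr_deriv ?_
    · filter_upwards [isOpen_ne.mem_nhds hx] with y hy using Function.update_of_ne hy _ _
    · congr 1
      push_cast
      field_simp
  induction n generalizing f a with
  | zero =>
    obtain ⟨c, -, h⟩ := hder hf ha
    exact contDiff_zero.2 (continuous_iff_continuousAt.2 fun x => (h x).continuousAt)
  | succ n ih =>
    obtain ⟨c, hc', h⟩ := hder hf ha
    rw [Nat.cast_succ, contDiff_succ_iff_deriv]
    refine ⟨fun x => (h x).differentiableAt, by simp, ?_⟩
    rw [funext fun x => (h x).deriv]
    exact ih hf.sq_mul_deriv hc'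

/-- `I_d` consists exactly of the smooth functions `φ` all of whose
derivatives have asymptotic expansions at infinity, the expansion of `φ` itself
starting at `x^{-d-1}` (i.e. `a_0 = ⋯ = a_d = 0`). -/
theorem memI_iff_asymptotics (d : ℕ) (hd : 0 < d) (φ : ℝ → ℂ) :
    MemI d φ ↔
      ContDiff ℝ (⊤ : ℕ∞) φ ∧
        (∀ n : ℕ, ∃ a : ℕ → ℂ, HasAsymptoticExpansion (iteratedDeriv n φ) a) ∧
        ∃ a : ℕ → ℂ, HasAsymptoticExpansion φ a ∧ ∀ m : ℕ, m ≤ d → a m = 0 := by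
  constructor
  · rintro ⟨hφ, ψ, hψ, h⟩
    have hval : ∀ x : ℝ, x ≠ 0 → φ x = ((-1 / x : ℝ) : ℂ) ^ (d + 1) * ψ (-1 / x) := by
      intro x hx
      have hx' : (x : ℂ) ≠ 0 := by exact_mod_cast hx
      rw [h (-1 / x) (by simp [hx]), show -1 / (-1 / x) = x by field_simp,
        mul_inv_cancel_left₀]
      simp [hx]
    refine ⟨hφ, (hasSmoothExpansion_of_eq_comp hφ
      (g := fun y => (y : ℂ) ^ (d + 1) * ψ y)
      ((Complex.ofRealCLM.contDiff.pow _).mul hψ) hval).2, ?_⟩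
    obtain ⟨a, ha⟩ := exists_hasAsymptoticExpansion_of_contDiff
      (contDiff_const (c := (-1 : ℂ) ^ (d + 1)) |>.mul hψ)
    obtain ⟨b, hb, hb0⟩ := ha.div_pow (d + 1)
    refine ⟨b, hb.congr fun x hx => ?_, fun m hm => hb0 m (by omega)⟩
    rw [hval x hx]
    push_cast
    rw [div_pow]
    ring
  · rintro ⟨hφ, hexp, a, ha, h0⟩
    have hF := HasSmoothExpansion.pow_mul ⟨hφ, hexp⟩ ha (k := d + 1) fun m hm => h0 m (by omega)
    obtain ⟨c, hc⟩ := hF.2 0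
    rw [iteratedDeriv_zero] at hc
    refine ⟨hφ, _, contDiff_const (c := (-1 : ℂ) ^ (d + 1)) |>.mul
      (contDiff_infty.2 (hF.contDiff_update hc)), fun x hx => ?_⟩
    have hx' : (x : ℂ) ≠ 0 := by exact_mod_cast hx
    rw [Function.update_of_ne hx, ← mul_assoc, ← mul_pow, ← inv_pow]
    congr 2
    push_cast
    field_simp
end

section
/- Let d be a positive integer and φ ∈ I_d. Then M_d(φ) is differentiable at every y ≠ 0, and D(M_d(φ)) ∈ S̃_d, where (Df)(y) = y f′(y); that is, the operator D maps S̃_d into itself. -/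
open MeasureTheory Set

/-- The normalized Fourier transform `φ̂(y) = (2π)^{-1/2} ∫_ℝ φ(x) e^{-ixy} dx`. -/
noncomputable def fourierHat (φ : ℝ → ℂ) (y : ℝ) : ℂ :=
  (((2 * Real.pi) ^ (-(1 : ℝ) / 2) : ℝ) : ℂ) * ∫ x : ℝ, φ x * Complex.exp (-(Complex.I * x * y))

/-- The operator `M_d(φ)(y) = |y|^{(1-d)/2} φ̂(y)`. -/
noncomputable def Md (d : ℕ) (φ : ℝ → ℂ) (y : ℝ) : ℂ :=
  ((|y| ^ ((1 - (d : ℝ)) / 2) : ℝ) : ℂ) * fourierHat φ y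

/-- Membership in `S̃_d = M_d(I_d)`, viewed as functions on `ℝ ∖ {0}`:
`f` agrees with `M_d(φ)` away from `0` for some `φ ∈ I_d`. -/
def MemStilde (d : ℕ) (f : ℝ → ℂ) : Prop :=
  ∃ φ : ℝ → ℂ, MemI d φ ∧ ∀ y : ℝ, y ≠ 0 → f y = Md d φ y

open FourierTransform

/-- The generator of the dilation action on `I_d`: `φ ↦ -((d + 1) / 2) φ - x φ'`. -/
noncomputable def dilationGenerator (d : ℕ) (φ : ℝ → ℂ) (x : ℝ) : ℂ :=
  (-((d : ℂ) + 1) / 2) * φ x - x * deriv φ x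

lemma contDiff_top_deriv {φ : ℝ → ℂ} (h : ContDiff ℝ (⊤ : ℕ∞) φ) :
    ContDiff ℝ (⊤ : ℕ∞) (deriv φ) :=
  (contDiff_infty_iff_deriv.mp h).2

lemma MemI.dilationGenerator {d : ℕ} {φ : ℝ → ℂ} (h : MemI d φ) :
    MemI d (dilationGenerator d φ) := by
  obtain ⟨hφ, ψ, hψ, hψφ⟩ := h
  have hx : ContDiff ℝ (⊤ : ℕ∞) (fun x : ℝ => (x : ℂ)) := Complex.ofRealCLM.contDiff
  refine ⟨(contDiff_const.mul hφ).sub (hx.mul (contDiff_top_deriv hφ)),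
    fun x => (((d : ℂ) + 1) / 2) * ψ x + x * deriv ψ x,
    (contDiff_const.mul hψ).add (hx.mul (contDiff_top_deriv hψ)), fun x hx0 => ?_⟩
  have hxC : (x : ℂ) ≠ 0 := by exact_mod_cast hx0
  have hinv : HasDerivAt (fun t : ℝ => -1 / t) (1 / x ^ 2) x := by
    have := (hasDerivAt_inv hx0).neg
    rw [show (fun t : ℝ => -1 / t) = -fun t => t⁻¹ by ext t; simp [neg_div]]
    exact this.congr_deriv (by simp)
  have hcomp : HasDerivAt (fun t : ℝ => φ (-1 / t)) ((1 / x ^ 2 : ℝ) • deriv φ (-1 / x)) x :=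
    HasDerivAt.scomp x (hφ.differentiable (by simp) _).hasDerivAt hinv
  have hpow : HasDerivAt (fun t : ℝ => (t : ℂ) ^ (d + 1)) (((d + 1 : ℕ) : ℂ) * x ^ d) x := by
    exact ((hasDerivAt_id x).ofReal_comp.pow (d + 1)).congr_deriv (by simp)
  have heq : (fun t : ℝ => (t : ℂ) ^ (d + 1) * ψ t) =ᶠ[nhds x] fun t => φ (-1 / t) := by
    filter_upwards [isOpen_ne.mem_nhds hx0] with t ht
    have htC : (t : ℂ) ≠ 0 := by exact_mod_cast ht
    rw [hψφ t ht, ← mul_assoc, mul_inv_cancel₀ (pow_ne_zero _ htC), one_mul]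
  have key := (hpow.mul (hψ.differentiable (by simp) x).hasDerivAt).unique
    (hcomp.congr_of_eventuallyEq heq)
  have hval := heq.eq_of_nhds
  simp only [Complex.real_smul, Complex.ofReal_div, Complex.ofReal_pow, Complex.ofReal_one] at key
  have hd1 : deriv φ (-1 / x) = (x : ℂ) ^ 2 * (((d + 1 : ℕ) : ℂ) * x ^ d * ψ x +
      (x : ℂ) ^ (d + 1) * deriv ψ x) := by
    rw [key]
    field_simp
  simp only [_root_.dilationGenerator]
  rw [hd1, ← hval]
  push_cast
  field_simp
  ring

lemma MemI.integrable {d : ℕ} (hd : 0 < d) {φ : ℝ → ℂ} (h : MemI d φ) : Integrable φ := by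
  obtain ⟨hφ, ψ, hψ, hψφ⟩ := h
  obtain ⟨A, hA⟩ := isCompact_Icc.exists_bound_of_continuousOn
    (s := Icc (-1 : ℝ) 1) hφ.continuous.continuousOn
  obtain ⟨B, hB⟩ := isCompact_Icc.exists_bound_of_continuousOn
    (s := Icc (-1 : ℝ) 1) hψ.continuous.continuousOn
  have hA0 : 0 ≤ A := (norm_nonneg _).trans (hA 0 (by simp))
  have hB0 : 0 ≤ B := (norm_nonneg _).trans (hB 0 (by simp))
  refine (integrable_inv_one_add_sq.const_mul (2 * (A + B))).mono'
    hφ.continuous.aestronglyMeasurable (Filter.Eventually.of_forall fun x => ?_)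
  rw [← div_eq_mul_inv, le_div_iff₀ (by positivity)]
  rcases le_total |x| 1 with hx | hx
  · have h1 := hA x (abs_le.mp hx)
    have h2 : x ^ 2 ≤ 1 := (sq_le_one_iff_abs_le_one x).mpr hx
    nlinarith [norm_nonneg (φ x)]
  · have hx0 : x ≠ 0 := by
      rintro rfl
      norm_num at hx
    have hxC : (x : ℂ) ≠ 0 := by exact_mod_cast hx0
    have ht : |-1 / x| ≤ 1 := by
      rw [abs_div, abs_neg, abs_one]
      exact div_le_one_of_le₀ hx (abs_nonneg x)
    have h1 := hB _ (abs_le.mp ht)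
    rw [hψφ _ (div_ne_zero (by norm_num) hx0), neg_div, div_neg, neg_div, neg_neg, one_div_one_div,
      norm_mul, norm_inv, norm_pow] at h1
    have h2 : ‖((-(1 / x) : ℝ) : ℂ)‖ = |x|⁻¹ := by
      rw [Complex.norm_real, norm_neg, one_div, norm_inv, Real.norm_eq_abs]
    rw [h2, inv_pow, inv_inv] at h1
    have h3 : |x| ^ 2 ≤ |x| ^ (d + 1) := pow_le_pow_right₀ hx (by omega)
    rw [sq_abs] at h3
    have h4 : 1 ≤ x ^ 2 := (one_le_sq_iff_one_le_abs x).mpr hx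
    nlinarith [norm_nonneg (φ x), mul_le_mul_of_nonneg_right h3 (norm_nonneg (φ x)),
      mul_le_mul_of_nonneg_right h4 (norm_nonneg (φ x))]

lemma MemI.integrable_mul_deriv {d : ℕ} (hd : 0 < d) {φ : ℝ → ℂ} (h : MemI d φ) :
    Integrable fun x : ℝ => (x : ℂ) * deriv φ x := by
  have := ((h.integrable hd).const_mul (-((d : ℂ) + 1) / 2)).sub (h.dilationGenerator.integrable hd)
  refine this.congr (Filter.Eventually.of_forall fun x => ?_)
  simp [_root_.dilationGenerator]

lemma Continuous.integrable_of_integrable_mul {f : ℝ → ℂ} (hf : Continuous f)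
    (h : Integrable fun x : ℝ => (x : ℂ) * f x) : Integrable f := by
  obtain ⟨A, hA⟩ := isCompact_Icc.exists_bound_of_continuousOn
    (s := Icc (-1 : ℝ) 1) hf.continuousOn
  have hA0 : 0 ≤ A := (norm_nonneg _).trans (hA 0 (by simp))
  refine (h.norm.add (integrable_inv_one_add_sq.const_mul (2 * A))).mono'
    hf.aestronglyMeasurable (Filter.Eventually.of_forall fun x => ?_)
  simp only [Pi.add_apply, norm_mul, Complex.norm_real, Real.norm_eq_abs]
  rcases le_total |x| 1 with hx | hx
  · have h1 := hA x (abs_le.mp hx)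
    have h2 : x ^ 2 ≤ 1 := (sq_le_one_iff_abs_le_one x).mpr hx
    have h3 : A ≤ 2 * A * (1 + x ^ 2)⁻¹ := by
      rw [← div_eq_mul_inv, le_div_iff₀ (by positivity)]
      nlinarith
    have h4 : 0 ≤ |x| * ‖f x‖ := by positivity
    linarith
  · have h3 : 0 ≤ 2 * A * (1 + x ^ 2)⁻¹ := by positivity
    nlinarith [norm_nonneg (f x)]

lemma fourierHat_eq_fourier (φ : ℝ → ℂ) (y : ℝ) :
    fourierHat φ y = (((2 * Real.pi) ^ (-(1 : ℝ) / 2) : ℝ) : ℂ) * 𝓕 φ (y / (2 * Real.pi)) := by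
  rw [fourierHat, Real.fourier_real_eq_integral_exp_smul]
  congr 1
  refine integral_congr_ae (Filter.Eventually.of_forall fun x => ?_)
  have hpi : (Real.pi : ℂ) ≠ 0 := by exact_mod_cast Real.pi_ne_zero
  simp only [smul_eq_mul]
  rw [mul_comm]
  congr 2
  push_cast
  field_simp

lemma integrable_mul_exp {φ : ℝ → ℂ} (h : Integrable φ) (y : ℝ) :
    Integrable fun x : ℝ => φ x * Complex.exp (-(Complex.I * x * y)) := by
  refine h.mul_bdd (c := 1) (by fun_prop) (Filter.Eventually.of_forall fun x => ?_)
  simp [Complex.norm_exp]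

lemma fourierHat_dilationGenerator {d : ℕ} {φ : ℝ → ℂ} (h : Integrable φ)
    (h' : Integrable fun x : ℝ => (x : ℂ) * deriv φ x) (y : ℝ) :
    fourierHat (dilationGenerator d φ) y =
      (-((d : ℂ) + 1) / 2) * fourierHat φ y - fourierHat (fun x => x * deriv φ x) y := by
  simp only [fourierHat, dilationGenerator, sub_mul]
  rw [integral_sub _ (integrable_mul_exp h' y)]
  · simp only [mul_assoc]
    rw [integral_const_mul]
    ring
  · exact integrable_mul_exp (h.const_mul _) y

lemma hasDerivAt_fourierHat {f : ℝ → ℂ} (hf : Integrable f)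
    (hf' : Integrable fun x : ℝ => (x : ℂ) * f x) (y : ℝ) :
    HasDerivAt (fourierHat f) (-Complex.I * fourierHat (fun x => x * f x) y) y := by
  have hpi : (Real.pi : ℂ) ≠ 0 := by exact_mod_cast Real.pi_ne_zero
  have h := (Real.hasDerivAt_fourier hf (by simpa using hf') (y / (2 * Real.pi))).scomp y
    ((hasDerivAt_id y).div_const (2 * Real.pi))
  have h2 := h.const_mul (((2 * Real.pi) ^ (-(1 : ℝ) / 2) : ℝ) : ℂ)
  rw [show fourierHat f = _ from funext (fourierHat_eq_fourier f)]
  have e : 𝓕 (fun x : ℝ => (-2 * Real.pi * Complex.I * x : ℂ) • f x) (y / (2 * Real.pi)) =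
      (-2 * Real.pi * Complex.I) * 𝓕 (fun x : ℝ => (x : ℂ) * f x) (y / (2 * Real.pi)) := by
    simp only [Real.fourier_real_eq_integral_exp_smul, smul_eq_mul]
    rw [← integral_const_mul]
    congr 1
    ext x
    ring
  refine h2.congr_deriv ?_
  rw [fourierHat_eq_fourier, e, Complex.real_smul]
  push_cast
  field_simp

lemma fourierHat_deriv {f : ℝ → ℂ} (hf : Integrable f) (hdf : Differentiable ℝ f)
    (hf' : Integrable (deriv f)) (y : ℝ) :
    fourierHat (deriv f) y = Complex.I * y * fourierHat f y := by
  have hpi : (Real.pi : ℂ) ≠ 0 := by exact_mod_cast Real.pi_ne_zero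
  rw [fourierHat_eq_fourier, fourierHat_eq_fourier, Real.fourier_deriv hf hdf hf']
  simp only [smul_eq_mul]
  push_cast
  field_simp

lemma hasDerivAt_fourierHat_of_ne_zero {f : ℝ → ℂ} (hf : Integrable f) (hdf : ContDiff ℝ 1 f)
    (hf' : Integrable fun x : ℝ => (x : ℂ) * deriv f x) {y : ℝ} (hy : y ≠ 0) :
    HasDerivAt (fourierHat f)
      ((-fourierHat f y - fourierHat (fun x => x * deriv f x) y) / y) y := by
  have hyC : (y : ℂ) ≠ 0 := by exact_mod_cast hy
  have h_deriv : Integrable (deriv f) :=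
    (hdf.continuous_deriv le_rfl).integrable_of_integrable_mul hf'
  have hF := fourierHat_deriv hf (hdf.differentiable (by simp)) h_deriv
  have hden : HasDerivAt (fun t : ℝ => Complex.I * (t : ℂ)) Complex.I y := by
    simpa using (hasDerivAt_id y).ofReal_comp.const_mul Complex.I
  have hquot := (hasDerivAt_fourierHat h_deriv hf' y).div hden (mul_ne_zero Complex.I_ne_zero hyC)
  have heq : fourierHat f =ᶠ[nhds y]
      (fun t => fourierHat (deriv f) t / (Complex.I * (t : ℂ))) := by
    filter_upwards [isOpen_ne.mem_nhds hy] with t ht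
    have htC : (t : ℂ) ≠ 0 := by exact_mod_cast ht
    rw [hF]
    field_simp
  refine (hquot.congr_of_eventuallyEq heq).congr_deriv ?_
  rw [hF]
  field_simp
  ring

lemma hasDerivAt_abs_rpow_of_ne_zero (p : ℝ) {y : ℝ} (hy : y ≠ 0) :
    HasDerivAt (fun t : ℝ => |t| ^ p) (p * |y| ^ p / y) y := by
  have hy' : |y| ≠ 0 := abs_ne_zero.mpr hy
  convert (hasDerivAt_abs hy).rpow_const (p := p) (Or.inl hy') using 1
  rw [Real.rpow_sub_one hy']
  rcases lt_or_gt_of_ne hy with h | h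
  · simp [sign_neg h, abs_of_neg h]
    field_simp
  · simp [sign_pos h, abs_of_pos h]
    field_simp

lemma MemI.hasDerivAt_Md {d : ℕ} (hd : 0 < d) {φ : ℝ → ℂ} (h : MemI d φ) {y : ℝ} (hy : y ≠ 0) :
    HasDerivAt (Md d φ) (Md d (_root_.dilationGenerator d φ) y / y) y := by
  have hyC : (y : ℂ) ≠ 0 := by exact_mod_cast hy
  have hφ := h.integrable hd
  have hφ' := h.integrable_mul_deriv hd
  have h1 := (hasDerivAt_abs_rpow_of_ne_zero ((1 - (d : ℝ)) / 2) hy).ofReal_comp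
  have h2 := hasDerivAt_fourierHat_of_ne_zero hφ (h.1.of_le (by simp)) hφ' hy
  refine (h1.mul h2).congr_deriv ?_
  rw [Md, fourierHat_dilationGenerator hφ hφ']
  push_cast
  field_simp
  ring

/-- for `φ ∈ I_d`, `M_d(φ)` is differentiable at every `y ≠ 0`, and the
operator `D`, `(Df)(y) = y f'(y)`, maps `S̃_d` into itself. -/
theorem Md_differentiable_and_D_stable (d : ℕ) (hd : 0 < d) :
    (∀ φ : ℝ → ℂ, MemI d φ → ∀ y : ℝ, y ≠ 0 → DifferentiableAt ℝ (Md d φ) y) ∧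
      ∀ f : ℝ → ℂ, MemStilde d f → MemStilde d (fun y => (y : ℂ) * deriv f y) := by
  refine ⟨fun φ h y hy => (h.hasDerivAt_Md hd hy).differentiableAt, ?_⟩
  rintro f ⟨φ, h, hf⟩
  refine ⟨dilationGenerator d φ, h.dilationGenerator, fun y hy => ?_⟩
  have hyC : (y : ℂ) ≠ 0 := by exact_mod_cast hy
  have heq : f =ᶠ[nhds y] Md d φ := by
    filter_upwards [isOpen_ne.mem_nhds hy] with t ht using hf t ht
  simp only
  rw [heq.deriv_eq, (h.hasDerivAt_Md hd hy).deriv, mul_div_cancel₀ _ hyC]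
end
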